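/- Let P1, P2 be d×d symmetric positive definite matrices and W1, W2 be d×d symmetric positive semidefinite matrices, and let F1, F2 be as defined in the context. Then for every symmetric positive definite matrix P with P ⪯ P1 + W1, one has F1(P1 + W1) + F2(P1 + W1) ≤ F1(P) + F2(P); that is, the minimum of F1 + F2 over such P is attained at P = P1 + W1 (and F1(P1 + W1) = 0). -/

import Mathlib

open Matrix

/-- Loewner order on symmetric matrices: `A ⪯ B` iff `B - A` is positive semidefinite. -/
def Loewner {d : ℕ} (A B : Matrix (Fin d) (Fin d) ℝ) : Prop := (B - A).PosSemidef

/-- `F1(P) = inf { log det (P1 + W1) - log det Q : Q positive definite,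
`Q ⪯ P1 + W1`, `Q ⪯ P` }`. -/
noncomputable def F1 {d : ℕ} (P1 W1 : Matrix (Fin d) (Fin d) ℝ)
    (P : Matrix (Fin d) (Fin d) ℝ) : ℝ :=
  sInf {r : ℝ | ∃ Q : Matrix (Fin d) (Fin d) ℝ, Q.PosDef ∧
    Loewner Q (P1 + W1) ∧ Loewner Q P ∧ r = Real.log (P1 + W1).det - Real.log Q.det}

/-- `F2(P) = inf { log det (P + W2) - log det Q : Q positive definite,
`Q ⪯ P + W2`, `Q ⪯ P2` }`. -/
noncomputable def F2 {d : ℕ} (P2 W2 : Matrix (Fin d) (Fin d) ℝ)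
    (P : Matrix (Fin d) (Fin d) ℝ) : ℝ :=
  sInf {r : ℝ | ∃ Q : Matrix (Fin d) (Fin d) ℝ, Q.PosDef ∧
    Loewner Q (P + W2) ∧ Loewner Q P2 ∧ r = Real.log (P + W2).det - Real.log Q.det}

namespace Matrix

variable {n : Type*} [Fintype n] [DecidableEq n]

theorem PosSemidef.exists_eq_conjTranspose_mul_self {S : Matrix n n ℝ} (hS : S.PosSemidef) :
    ∃ B : Matrix n n ℝ, S = Bᴴ * B := by
  open scoped MatrixOrder in
  exact CStarAlgebra.nonneg_iff_eq_star_mul_self.mp hS.nonneg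

theorem PosSemidef.one_le_det_one_add {S : Matrix n n ℝ} (hS : S.PosSemidef) :
    1 ≤ (1 + S).det := by
  have h : (1 + S).IsHermitian := isHermitian_one.add hS.1
  rw [h.det_eq_prod_eigenvalues]
  refine Finset.one_le_prod fun i _ => ?_
  have hv : (1 + S) *ᵥ (h.eigenvectorBasis i) = h.eigenvalues i • ⇑(h.eigenvectorBasis i) :=
    h.mulVec_eigenvectorBasis i
  have hne : (h.eigenvectorBasis i : n → ℝ) ⬝ᵥ (h.eigenvectorBasis i) = 1 := by
    have := h.eigenvectorBasis.orthonormal.1 i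
    rw [EuclideanSpace.norm_eq, Real.sqrt_eq_one] at this
    simpa [dotProduct, sq] using this
  have hS' := hS.dotProduct_mulVec_nonneg (h.eigenvectorBasis i)
  have := congrArg (fun w => (h.eigenvectorBasis i : n → ℝ) ⬝ᵥ w) hv
  simp only [add_mulVec, one_mulVec, dotProduct_add, dotProduct_smul, hne, smul_eq_mul,
    mul_one] at this
  simp only [star_trivial] at hS'
  change 1 ≤ h.eigenvalues i
  linarith

theorem PosDef.det_add_conjTranspose_mul_self {M : Matrix n n ℝ} (hM : M.PosDef)
    (B : Matrix n n ℝ) : (M + Bᴴ * B).det = M.det * (1 + B * M⁻¹ * Bᴴ).det := by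
  have hu : IsUnit M.det := hM.det_pos.ne'.isUnit
  rw [mul_assoc B, det_one_add_mul_comm, ← det_mul, mul_add, mul_one, ← mul_assoc, ← mul_assoc,
    mul_nonsing_inv _ hu, one_mul]

theorem PosDef.det_le_det {M N : Matrix n n ℝ} (hM : M.PosDef) (h : (N - M).PosSemidef) :
    M.det ≤ N.det := by
  obtain ⟨B, hB⟩ := h.exists_eq_conjTranspose_mul_self
  rw [← add_sub_cancel M N, hB, hM.det_add_conjTranspose_mul_self]
  exact le_mul_of_one_le_right hM.det_pos.le
    (hM.inv.posSemidef.mul_mul_conjTranspose_same B).one_le_det_one_add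

theorem PosDef.posSemidef_inv_sub_inv {M N : Matrix n n ℝ} (hM : M.PosDef)
    (h : (N - M).PosSemidef) : (M⁻¹ - N⁻¹).PosSemidef := by
  have hN : N.PosDef := by simpa using hM.add_posSemidef h
  let := hN.isUnit.invertible
  let := hM.inv.isUnit.invertible
  have h₁ := hN.fromBlocks₁₁ (1 : Matrix n n ℝ) M⁻¹
  have h₂ := hM.inv.fromBlocks₂₂ N (1 : Matrix n n ℝ)
  rw [nonsing_inv_nonsing_inv _ hM.det_pos.ne'.isUnit] at h₂
  simp only [conjTranspose_one, one_mul, mul_one] at h₁ h₂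
  exact h₁.mp (h₂.mpr h)

theorem PosDef.det_add_mul_det_le {M N W : Matrix n n ℝ} (hM : M.PosDef)
    (h : (N - M).PosSemidef) (hW : W.PosSemidef) :
    (N + W).det * M.det ≤ N.det * (M + W).det := by
  have hN : N.PosDef := by simpa using hM.add_posSemidef h
  obtain ⟨B, rfl⟩ := hW.exists_eq_conjTranspose_mul_self
  rw [hN.det_add_conjTranspose_mul_self, hM.det_add_conjTranspose_mul_self, mul_assoc,
    mul_comm _ M.det]
  refine mul_le_mul_of_nonneg_left (mul_le_mul_of_nonneg_left ?_ hM.det_pos.le) hN.det_pos.le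
  refine PosDef.det_le_det
    (PosDef.one.add_posSemidef (hN.inv.posSemidef.mul_mul_conjTranspose_same B)) ?_
  have := (hM.posSemidef_inv_sub_inv h).mul_mul_conjTranspose_same B
  rwa [mul_sub, sub_mul, ← add_sub_add_left_eq_sub _ _ 1] at this

theorem PosDef.exists_posDef_le_le {M N : Matrix n n ℝ} (hM : M.PosDef) (hN : N.PosDef) :
    ∃ Q : Matrix n n ℝ, Q.PosDef ∧ (M - Q).PosSemidef ∧ (N - Q).PosSemidef := by
  refine ⟨(M⁻¹ + N⁻¹)⁻¹, (hM.inv.add hN.inv).inv, ?_, ?_⟩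
  · have := hM.inv.posSemidef_inv_sub_inv (N := M⁻¹ + N⁻¹) (by simpa using hN.inv.posSemidef)
    rwa [nonsing_inv_nonsing_inv _ hM.det_pos.ne'.isUnit] at this
  · have := hN.inv.posSemidef_inv_sub_inv (N := M⁻¹ + N⁻¹) (by simpa using hM.inv.posSemidef)
    rwa [nonsing_inv_nonsing_inv _ hN.det_pos.ne'.isUnit] at this

end Matrix

theorem F1_eq_log_det_sub_log_det {d : ℕ} {P1 W1 P : Matrix (Fin d) (Fin d) ℝ}
    (hP : P.PosDef) (h : Loewner P (P1 + W1)) :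
    F1 P1 W1 P = Real.log (P1 + W1).det - Real.log P.det := by
  refine IsLeast.csInf_eq ⟨⟨P, hP, h, by simpa [Loewner] using PosSemidef.zero, rfl⟩, ?_⟩
  rintro r ⟨Q, hQ, -, hQP, rfl⟩
  exact sub_le_sub_left (Real.log_le_log hQ.det_pos (hQ.det_le_det hQP)) _

theorem F2_le_F2_add_log_det_sub {d : ℕ} {P2 W2 P A : Matrix (Fin d) (Fin d) ℝ}
    (hP2 : P2.PosDef) (hW2 : W2.PosSemidef) (hP : P.PosDef) (h : Loewner P A) :
    F2 P2 W2 A ≤ F2 P2 W2 P + (Real.log (A + W2).det - Real.log (P + W2).det) := by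
  rw [← sub_le_iff_le_add]
  obtain ⟨Q₀, hQ₀, hQ₀P, hQ₀P2⟩ := (hP.add_posSemidef hW2).exists_posDef_le_le hP2
  refine le_csInf ⟨_, Q₀, hQ₀, hQ₀P, hQ₀P2, rfl⟩ ?_
  rintro r ⟨Q, hQ, hQP, hQP2, rfl⟩
  have hQA : Loewner Q (A + W2) := by
    have := PosSemidef.add hQP h
    rwa [show P + W2 - Q + (A - P) = A + W2 - Q by abel] at this
  have hle : F2 P2 W2 A ≤ Real.log (A + W2).det - Real.log Q.det := by
    refine csInf_le ⟨0, ?_⟩ ⟨Q, hQ, hQA, hQP2, rfl⟩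
    rintro s ⟨R, hR, hRA, -, rfl⟩
    exact sub_nonneg.mpr (Real.log_le_log hR.det_pos (hR.det_le_det hRA))
  linarith

/-- Proposition 2: the minimum of `F1 + F2` over positive definite
`P ⪯ P1 + W1` is attained at `P = P1 + W1`, and `F1(P1 + W1) = 0`. -/
theorem F12_optimal_at_P1_add_W1
    (d : ℕ) (P1 P2 W1 W2 : Matrix (Fin d) (Fin d) ℝ)
    (hP1 : P1.PosDef) (hP2 : P2.PosDef) (hW1 : W1.PosSemidef) (hW2 : W2.PosSemidef) :
    (∀ P : Matrix (Fin d) (Fin d) ℝ, P.PosDef → Loewner P (P1 + W1) →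
      F1 P1 W1 (P1 + W1) + F2 P2 W2 (P1 + W1) ≤ F1 P1 W1 P + F2 P2 W2 P) ∧
    F1 P1 W1 (P1 + W1) = 0 := by
  have hA : (P1 + W1).PosDef := hP1.add_posSemidef hW1
  have hF1 : F1 P1 W1 (P1 + W1) = 0 := by
    rw [F1_eq_log_det_sub_log_det hA (by simpa [Loewner] using PosSemidef.zero), sub_self]
  refine ⟨fun P hP hPA => ?_, hF1⟩
  have hF2 := F2_le_F2_add_log_det_sub hP2 hW2 hP hPA
  have hAW := (hA.add_posSemidef hW2).det_pos
  have hPW := (hP.add_posSemidef hW2).det_pos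
  have hlog := Real.log_le_log (mul_pos hAW hP.det_pos) (hP.det_add_mul_det_le hPA hW2)
  rw [Real.log_mul hAW.ne' hP.det_pos.ne', Real.log_mul hA.det_pos.ne' hPW.ne'] at hlog
  rw [hF1, F1_eq_log_det_sub_log_det hP hPA]
  linarith
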